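/- arXiv:1205.3127 — 2 statements merged into one kernel-verified Lean document; each statement's English description precedes it below -/
import Mathlib

section
/- Let α, β : Fin s → Fin n be two sequences of length s ≥ 4. Suppose the image of α has at most 3 distinct elements and the image of β has at most 2 distinct elements (i.e. α = (a_1,…,a_1,a_2,…,a_2,a_3,…,a_3) and β = (b_1,…,b_1,b_2,…,b_2)). Then T_{α,β} ∈ span(J_1 ∪ J_2 ∪ J_3). -/
open MvPolynomial

/-- The exponent vector of the gcd of two monomials: the pointwise minimum
of the two exponent vectors. -/
noncomputable def expGcd {σ : Type*} (a b : σ →₀ ℕ) : σ →₀ ℕ := a ⊓ b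

/-- A square-free exponent vector: all exponents are `0` or `1`. -/
def SqFreeExp {σ : Type*} (a : σ →₀ ℕ) : Prop := ∀ x, a x ≤ 1

variable (k : Type*) [Field k] {σ : Type*} {n : ℕ}

/-- The Taylor binomial `T_{α,β} = (f_β / gcd(f_α,f_β)) T_α - (f_α / gcd(f_α,f_β)) T_β`
associated to two sequences `α β : Fin s → Fin n`, where `f_i` is the monomial with
exponent vector `e i`.  It lives in `S = R[T_1,…,T_n]`, realized as
`MvPolynomial (Fin n) (MvPolynomial σ k)`. -/
noncomputable def Tab (e : Fin n → (σ →₀ ℕ)) {s : ℕ} (α β : Fin s → Fin n) :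
    MvPolynomial (Fin n) (MvPolynomial σ k) :=
  C (monomial ((∑ i, e (β i)) - expGcd (∑ i, e (α i)) (∑ i, e (β i))) (1 : k)) *
      (∏ i, X (α i))
  - C (monomial ((∑ i, e (α i)) - expGcd (∑ i, e (α i)) (∑ i, e (β i))) (1 : k)) *
      (∏ i, X (β i))

/-- `J_s`, the set of all Taylor binomials coming from pairs of sequences of length `s`. -/
noncomputable def Jset (e : Fin n → (σ →₀ ℕ)) (s : ℕ) :
    Set (MvPolynomial (Fin n) (MvPolynomial σ k)) :=
  { p | ∃ α β : Fin s → Fin n, p = Tab k e α β }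

/-- The map `φ : S = R[T_1,…,T_n] → R[t]` sending `T_i ↦ f_i t`; its kernel is the
defining ideal of the Rees algebra `R[It]`. -/
noncomputable def reesMap (e : Fin n → (σ →₀ ℕ)) :
    MvPolynomial (Fin n) (MvPolynomial σ k) →ₐ[MvPolynomial σ k]
      Polynomial (MvPolynomial σ k) :=
  aeval fun i => Polynomial.C (monomial (e i) (1 : k)) * Polynomial.X

/-- The exponent vector of the product of the monomials `f_i`, `i` running over a multiset. -/
noncomputable def multisetExp (e : Fin n → (σ →₀ ℕ)) (M : Multiset (Fin n)) : σ →₀ ℕ :=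
  (M.map e).sum

/-- The lift `(X^L / f_M) T_M` to `S` of the monomial `X^L t^{|M|}` of the Rees algebra. -/
noncomputable def monomialLift (e : Fin n → (σ →₀ ℕ)) (L : σ →₀ ℕ) (M : Multiset (Fin n)) :
    MvPolynomial (Fin n) (MvPolynomial σ k) :=
  C (monomial (L - multisetExp e M) (1 : k)) * (M.map X).prod

lemma multisetExp_add (e : Fin n → (σ →₀ ℕ)) (M N : Multiset (Fin n)) :
    multisetExp e (M + N) = multisetExp e M + multisetExp e N := by
  simp [multisetExp]

lemma multisetExp_replicate_apply (e : Fin n → (σ →₀ ℕ)) (m : ℕ) (a : Fin n) (x : σ) :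
    multisetExp e (Multiset.replicate m a) x = m * e a x := by
  simp [multisetExp]

lemma monomialLift_add (e : Fin n → (σ →₀ ℕ)) (L : σ →₀ ℕ) (K M : Multiset (Fin n)) :
    monomialLift k e L (K + M) =
      (K.map X).prod * monomialLift k e (L - multisetExp e K) M := by
  simp only [monomialLift, multisetExp_add, Multiset.map_add, Multiset.prod_add, tsub_tsub]
  ring

lemma multisetExp_map_univ (e : Fin n → (σ →₀ ℕ)) {s : ℕ} (γ : Fin s → Fin n) :
    multisetExp e (Finset.univ.val.map γ) = ∑ i, e (γ i) := by
  rw [multisetExp, Multiset.map_map]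
  rfl

lemma exists_map_univ_eq (M : Multiset (Fin n)) :
    ∃ α : Fin M.card → Fin n, Finset.univ.val.map α = M := by
  induction M using Quotient.inductionOn with
  | h l => exact ⟨l.get, (Fin.univ_val_map _).trans (congrArg _ (List.ofFn_get l))⟩

lemma Tab_eq_monomialLift_sub (e : Fin n → (σ →₀ ℕ)) {s : ℕ} (α β : Fin s → Fin n) :
    Tab k e α β =
      monomialLift k e ((∑ i, e (α i)) ⊔ ∑ i, e (β i)) (Finset.univ.val.map α) -
      monomialLift k e ((∑ i, e (α i)) ⊔ ∑ i, e (β i)) (Finset.univ.val.map β) := by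
  have hX (γ : Fin s → Fin n) : ((Finset.univ.val.map γ).map
      (X : Fin n → MvPolynomial (Fin n) (MvPolynomial σ k))).prod = ∏ i, X (γ i) := by
    rw [Multiset.map_map]
    rfl
  simp only [Tab, monomialLift, multisetExp_map_univ, hX, expGcd]
  congr 4 <;> congr 1 <;> ext x <;> simp <;> omega

lemma monomialLift_sub_mem_of_tab_mem (e : Fin n → (σ →₀ ℕ))
    (I : Ideal (MvPolynomial (Fin n) (MvPolynomial σ k))) {s : ℕ} (α β : Fin s → Fin n)
    (h : Tab k e α β ∈ I) (L : σ →₀ ℕ)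
    (hα : multisetExp e (Finset.univ.val.map α) ≤ L)
    (hβ : multisetExp e (Finset.univ.val.map β) ≤ L) :
    monomialLift k e L (Finset.univ.val.map α) -
      monomialLift k e L (Finset.univ.val.map β) ∈ I := by
  rw [Tab_eq_monomialLift_sub] at h
  rw [multisetExp_map_univ] at hα hβ
  set U := (∑ i, e (α i)) ⊔ ∑ i, e (β i) with hU
  have hUL : U ≤ L := sup_le hα hβ
  have key (γ : Fin s → Fin n) (hγ : ∑ i, e (γ i) ≤ U) :
      monomialLift k e L (Finset.univ.val.map γ) =
        C (monomial (L - U) (1 : k)) * monomialLift k e U (Finset.univ.val.map γ) := by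
    simp only [monomialLift, multisetExp_map_univ]
    rw [← mul_assoc, ← C_mul, monomial_mul, one_mul, tsub_add_tsub_cancel hUL hγ]
  rw [key α le_sup_left, key β le_sup_right, ← mul_sub]
  exact I.mul_mem_left _ h

lemma monomialLift_sub_mem_of_card_le_three (e : Fin n → (σ →₀ ℕ)) (L : σ →₀ ℕ)
    (M N : Multiset (Fin n)) (hcard : M.card = N.card) (h3 : M.card ≤ 3)
    (hM : multisetExp e M ≤ L) (hN : multisetExp e N ≤ L) :
    monomialLift k e L M - monomialLift k e L N ∈
      Ideal.span (Jset k e 1 ∪ Jset k e 2 ∪ Jset k e 3) := by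
  obtain ⟨α, hα⟩ := exists_map_univ_eq M
  obtain ⟨β, hβ⟩ : ∃ β : Fin M.card → Fin n, Finset.univ.val.map β = N :=
    hcard ▸ exists_map_univ_eq N
  rcases Nat.eq_zero_or_pos M.card with h0 | h0
  · rw [Multiset.card_eq_zero.1 h0, Multiset.card_eq_zero.1 (hcard.symm.trans h0), sub_self]
    exact zero_mem _
  · have hT : Tab k e α β ∈ Ideal.span (Jset k e 1 ∪ Jset k e 2 ∪ Jset k e 3) := by
      have hJ : Jset k e M.card ⊆ Jset k e 1 ∪ Jset k e 2 ∪ Jset k e 3 := by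
        obtain h | h | h : M.card = 1 ∨ M.card = 2 ∨ M.card = 3 := by omega
        all_goals rw [h]; intro; simp +contextual
      exact Ideal.subset_span (hJ ⟨α, β, rfl⟩)
    have := monomialLift_sub_mem_of_tab_mem k e _ α β hT L (by rwa [hα]) (by rwa [hβ])
    rwa [hα, hβ] at this

/-- Some `r ≤ p` and `v ≤ q` of equal total size between `1` and `3` such that replacing, in the
product of monomials with multiplicities `p`, the part `r` by the part `v` stays below every
common bound of the products with multiplicities `p` and `q`, for all square-free monomials. -/
def HasSmallExchange (p₁ p₂ p₃ q₁ q₂ : ℕ) : Prop :=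
  ∃ r₁ r₂ r₃ v₁ v₂ : ℕ, r₁ ≤ p₁ ∧ r₂ ≤ p₂ ∧ r₃ ≤ p₃ ∧ v₁ ≤ q₁ ∧ v₂ ≤ q₂ ∧
    r₁ + r₂ + r₃ = v₁ + v₂ ∧ 1 ≤ v₁ + v₂ ∧ v₁ + v₂ ≤ 3 ∧
    ∀ a₁ a₂ a₃ b₁ b₂ L : ℕ, a₁ ≤ 1 → a₂ ≤ 1 → a₃ ≤ 1 → b₁ ≤ 1 → b₂ ≤ 1 →
      p₁ * a₁ + p₂ * a₂ + p₃ * a₃ ≤ L → q₁ * b₁ + q₂ * b₂ ≤ L →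
      (p₁ - r₁) * a₁ + (p₂ - r₂) * a₂ + (p₃ - r₃) * a₃ + (v₁ * b₁ + v₂ * b₂) ≤ L

namespace HasSmallExchange

variable {p₁ p₂ p₃ q₁ q₂ : ℕ}

lemma swap_left (h : HasSmallExchange p₁ p₂ p₃ q₁ q₂) : HasSmallExchange p₂ p₁ p₃ q₁ q₂ := by
  obtain ⟨r₁, r₂, r₃, v₁, v₂, h₁, h₂, h₃, h₄, h₅, h₆, h₇, h₈, H⟩ := h
  refine ⟨r₂, r₁, r₃, v₁, v₂, h₂, h₁, h₃, h₄, h₅, by omega, h₇, h₈, ?_⟩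
  intro a₁ a₂ a₃ b₁ b₂ L g₁ g₂ g₃ g₄ g₅ hp hq
  linarith [H a₂ a₁ a₃ b₁ b₂ L g₂ g₁ g₃ g₄ g₅ (by linarith) hq]

lemma swap_right (h : HasSmallExchange p₁ p₂ p₃ q₁ q₂) : HasSmallExchange p₁ p₃ p₂ q₁ q₂ := by
  obtain ⟨r₁, r₂, r₃, v₁, v₂, h₁, h₂, h₃, h₄, h₅, h₆, h₇, h₈, H⟩ := h
  refine ⟨r₁, r₃, r₂, v₁, v₂, h₁, h₃, h₂, h₄, h₅, by omega, h₇, h₈, ?_⟩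
  intro a₁ a₂ a₃ b₁ b₂ L g₁ g₂ g₃ g₄ g₅ hp hq
  linarith [H a₁ a₃ a₂ b₁ b₂ L g₁ g₃ g₂ g₄ g₅ (by linarith) hq]

lemma swap_target (h : HasSmallExchange p₁ p₂ p₃ q₁ q₂) : HasSmallExchange p₁ p₂ p₃ q₂ q₁ := by
  obtain ⟨r₁, r₂, r₃, v₁, v₂, h₁, h₂, h₃, h₄, h₅, h₆, h₇, h₈, H⟩ := h
  refine ⟨r₁, r₂, r₃, v₂, v₁, h₁, h₂, h₃, h₅, h₄, by omega, by omega, by omega, ?_⟩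
  intro a₁ a₂ a₃ b₁ b₂ L g₁ g₂ g₃ g₄ g₅ hp hq
  linarith [H a₁ a₂ a₃ b₂ b₁ L g₁ g₂ g₃ g₅ g₄ hp (by linarith)]

lemma of_sorted (hs : p₁ + p₂ + p₃ = q₁ + q₂) (h0 : 0 < q₁ + q₂)
    (h₁₂ : p₂ ≤ p₁) (h₂₃ : p₃ ≤ p₂) (hq : q₂ ≤ q₁) : HasSmallExchange p₁ p₂ p₃ q₁ q₂ := by
  obtain h | h | h : q₂ < p₁ ∨ (p₁ ≤ q₂ ∧ p₃ < q₂) ∨ (p₁ ≤ q₂ ∧ q₂ ≤ p₃) := by omega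
  · refine ⟨1, 0, 0, 1, 0, by omega, by omega, by omega, by omega, by omega, by omega,
      by omega, by omega, ?_⟩
    intro a₁ a₂ a₃ b₁ b₂ L g₁ g₂ g₃ g₄ g₅
    interval_cases a₁ <;> interval_cases a₂ <;> interval_cases a₃ <;> interval_cases b₁ <;>
      interval_cases b₂ <;> omega
  · refine ⟨1, 1, 0, 1, 1, by omega, by omega, by omega, by omega, by omega, by omega,
      by omega, by omega, ?_⟩
    intro a₁ a₂ a₃ b₁ b₂ L g₁ g₂ g₃ g₄ g₅
    interval_cases a₁ <;> interval_cases a₂ <;> interval_cases a₃ <;> interval_cases b₁ <;>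
      interval_cases b₂ <;> omega
  · refine ⟨1, 1, 1, 2, 1, by omega, by omega, by omega, by omega, by omega, by omega,
      by omega, by omega, ?_⟩
    intro a₁ a₂ a₃ b₁ b₂ L g₁ g₂ g₃ g₄ g₅
    interval_cases a₁ <;> interval_cases a₂ <;> interval_cases a₃ <;> interval_cases b₁ <;>
      interval_cases b₂ <;> omega

lemma of_sum_eq (hs : p₁ + p₂ + p₃ = q₁ + q₂) (h0 : 0 < q₁ + q₂) :
    HasSmallExchange p₁ p₂ p₃ q₁ q₂ := by
  wlog hq : q₂ ≤ q₁ generalizing q₁ q₂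
  · exact (this (by omega) (by omega) (by omega)).swap_target
  rcases le_total p₂ p₁ with h₁₂ | h₁₂ <;> rcases le_total p₃ p₂ with h₂₃ | h₂₃ <;>
    rcases le_total p₃ p₁ with h₁₃ | h₁₃
  · exact of_sorted hs h0 h₁₂ h₂₃ hq
  · exact of_sorted hs h0 h₁₂ h₂₃ hq
  · exact (of_sorted (by omega) h0 h₁₃ h₂₃ hq).swap_right
  · exact (of_sorted (by omega) h0 h₁₃ h₁₂ hq).swap_left.swap_right
  · exact (of_sorted (by omega) h0 h₁₂ h₁₃ hq).swap_left
  · exact (of_sorted (by omega) h0 h₂₃ h₁₃ hq).swap_right.swap_left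
  · exact (of_sorted (by omega) h0 h₂₃ h₁₂ hq).swap_left.swap_right.swap_left
  · exact (of_sorted (by omega) h0 h₂₃ h₁₂ hq).swap_left.swap_right.swap_left

end HasSmallExchange

lemma exists_eq_replicate_add_replicate (M : Multiset (Fin n)) (b₁ b₂ : Fin n)
    (h : ∀ x ∈ M, x = b₁ ∨ x = b₂) :
    ∃ q₁ q₂, M = Multiset.replicate q₁ b₁ + Multiset.replicate q₂ b₂ := by
  induction M using Multiset.induction with
  | empty => exact ⟨0, 0, by simp⟩
  | cons x M ih =>
    obtain ⟨q₁, q₂, rfl⟩ := ih fun y hy => h y (Multiset.mem_cons_of_mem hy)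
    rcases h x (Multiset.mem_cons_self _ _) with rfl | rfl
    · exact ⟨q₁ + 1, q₂, by simp [Multiset.replicate_succ]⟩
    · exact ⟨q₁, q₂ + 1, by simp [Multiset.replicate_succ]⟩

lemma exists_eq_replicate_add_replicate_add_replicate (M : Multiset (Fin n)) (a₁ a₂ a₃ : Fin n)
    (h : ∀ x ∈ M, x = a₁ ∨ x = a₂ ∨ x = a₃) :
    ∃ p₁ p₂ p₃, M = Multiset.replicate p₁ a₁ + Multiset.replicate p₂ a₂ +
      Multiset.replicate p₃ a₃ := by
  induction M using Multiset.induction with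
  | empty => exact ⟨0, 0, 0, by simp⟩
  | cons x M ih =>
    obtain ⟨p₁, p₂, p₃, rfl⟩ := ih fun y hy => h y (Multiset.mem_cons_of_mem hy)
    rcases h x (Multiset.mem_cons_self _ _) with rfl | rfl | rfl
    · exact ⟨p₁ + 1, p₂, p₃, by simp [Multiset.replicate_succ]⟩
    · exact ⟨p₁, p₂ + 1, p₃, by simp [Multiset.replicate_succ]⟩
    · exact ⟨p₁, p₂, p₃ + 1, by simp [Multiset.replicate_succ]⟩

lemma monomialLift_replicate_sub_mem (e : Fin n → (σ →₀ ℕ)) (hsf : ∀ i, SqFreeExp (e i))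
    (a₁ a₂ a₃ b₁ b₂ : Fin n) (L : σ →₀ ℕ) (p₁ p₂ p₃ q₁ q₂ : ℕ)
    (hs : p₁ + p₂ + p₃ = q₁ + q₂)
    (hP : multisetExp e (Multiset.replicate p₁ a₁ + Multiset.replicate p₂ a₂ +
      Multiset.replicate p₃ a₃) ≤ L)
    (hQ : multisetExp e (Multiset.replicate q₁ b₁ + Multiset.replicate q₂ b₂) ≤ L) :
    monomialLift k e L (Multiset.replicate p₁ a₁ + Multiset.replicate p₂ a₂ +
        Multiset.replicate p₃ a₃) -
      monomialLift k e L (Multiset.replicate q₁ b₁ + Multiset.replicate q₂ b₂) ∈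
      Ideal.span (Jset k e 1 ∪ Jset k e 2 ∪ Jset k e 3) := by
  induction hd : q₁ + q₂ using Nat.strong_induction_on generalizing L p₁ p₂ p₃ q₁ q₂ with
  | _ d ih =>
    rcases Nat.eq_zero_or_pos (q₁ + q₂) with h0 | h0
    · exact monomialLift_sub_mem_of_card_le_three k e L _ _ (by simpa using hs)
        (by simp; omega) hP hQ
    obtain ⟨r₁, r₂, r₃, v₁, v₂, h₁, h₂, h₃, h₄, h₅, hrv, hv0, hv3, H⟩ :=
      HasSmallExchange.of_sum_eq hs h0
    set M := Multiset.replicate r₁ a₁ + Multiset.replicate r₂ a₂ +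
      Multiset.replicate r₃ a₃ with hM
    set N := Multiset.replicate v₁ b₁ + Multiset.replicate v₂ b₂ with hN
    set P := Multiset.replicate (p₁ - r₁) a₁ + Multiset.replicate (p₂ - r₂) a₂ +
      Multiset.replicate (p₃ - r₃) a₃ with hP'
    set Q := Multiset.replicate (q₁ - v₁) b₁ + Multiset.replicate (q₂ - v₂) b₂ with hQ'
    have hPM : Multiset.replicate p₁ a₁ + Multiset.replicate p₂ a₂ +
        Multiset.replicate p₃ a₃ = P + M := by
      rw [hM, hP', add_add_add_comm, add_add_add_comm (Multiset.replicate _ a₁), ← Multiset.replicate_add,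
        ← Multiset.replicate_add, ← Multiset.replicate_add, Nat.sub_add_cancel h₁,
        Nat.sub_add_cancel h₂, Nat.sub_add_cancel h₃]
    have hNQ : Multiset.replicate q₁ b₁ + Multiset.replicate q₂ b₂ = N + Q := by
      rw [hN, hQ', add_add_add_comm, ← Multiset.replicate_add, ← Multiset.replicate_add,
        Nat.add_sub_cancel' h₄, Nat.add_sub_cancel' h₅]
    have hPN : multisetExp e (P + N) ≤ L := by
      intro x
      have hPx := hP x
      have hQx := hQ x
      simp only [hP', hN, multisetExp_add, Finsupp.add_apply,
        multisetExp_replicate_apply] at hPx hQx ⊢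
      exact H _ _ _ _ _ _ (hsf _ x) (hsf _ x) (hsf _ x) (hsf _ x) (hsf _ x) hPx hQx
    rw [hPM] at hP ⊢
    rw [hNQ] at hQ ⊢
    have le_tsub {A B : Multiset (Fin n)} (h : multisetExp e (A + B) ≤ L) :
        multisetExp e B ≤ L - multisetExp e A := by
      rw [multisetExp_add] at h
      exact le_tsub_of_add_le_left h
    rw [← sub_add_sub_cancel _ (monomialLift k e L (P + N))]
    refine add_mem ?_ ?_
    · rw [monomialLift_add k e L P M, monomialLift_add k e L P N, ← mul_sub]
      exact Ideal.mul_mem_left _ _ <| monomialLift_sub_mem_of_card_le_three k e _ M N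
        (by simpa [hM, hN] using hrv) (by simp [hM]; omega) (le_tsub hP) (le_tsub hPN)
    · rw [add_comm P N] at hPN ⊢
      rw [monomialLift_add k e L N P, monomialLift_add k e L N Q, ← mul_sub]
      exact Ideal.mul_mem_left _ _ <| ih (q₁ - v₁ + (q₂ - v₂)) (by omega) _ _ _ _ _ _
        (by omega) (le_tsub hPN) (le_tsub hQ) rfl

/-- If `s ≥ 4`, `α` takes at most `3` distinct values and `β` takes at most `2` distinct
values, then `T_{α,β} ∈ span(J_1 ∪ J_2 ∪ J_3)`. -/
theorem Tab_mem_of_three_two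
    (e : Fin n → (σ →₀ ℕ)) (hsf : ∀ i, SqFreeExp (e i))
    (hmin : ∀ i j : Fin n, i ≠ j →
      ¬ ((monomial (e i) (1 : k) : MvPolynomial σ k) ∣ monomial (e j) (1 : k)))
    {s : ℕ} (hs : 4 ≤ s) (α β : Fin s → Fin n)
    (a₁ a₂ a₃ b₁ b₂ : Fin n)
    (hα : ∀ i, α i = a₁ ∨ α i = a₂ ∨ α i = a₃) (hβ : ∀ i, β i = b₁ ∨ β i = b₂) :
    Tab k e α β ∈ Ideal.span (Jset k e 1 ∪ Jset k e 2 ∪ Jset k e 3) := by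
  obtain ⟨p₁, p₂, p₃, hp⟩ := exists_eq_replicate_add_replicate_add_replicate
    (Finset.univ.val.map α) a₁ a₂ a₃ (by simpa using hα)
  obtain ⟨q₁, q₂, hq⟩ := exists_eq_replicate_add_replicate
    (Finset.univ.val.map β) b₁ b₂ (by simpa using hβ)
  have hp' := congrArg Multiset.card hp
  have hq' := congrArg Multiset.card hq
  simp at hp' hq'
  rw [Tab_eq_monomialLift_sub, hp, hq]
  refine monomialLift_replicate_sub_mem k e hsf _ _ _ _ _ _ _ _ _ _ _ (by omega) ?_ ?_
  · rw [← hp, multisetExp_map_univ]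
    exact le_sup_left
  · rw [← hq, multisetExp_map_univ]
    exact le_sup_right
end

section
/- Suppose I is generated by n ≤ 5 square-free monomials. Then the defining ideal of the Rees algebra satisfies ker φ = span(J_1 ∪ J_2 ∪ … ∪ J_{n-2}) (where for n ≤ 3 the right-hand side is span(J_1)). In particular the relation type of I is at most n − 2. -/
open MvPolynomial

variable (k : Type*) [Field k] {σ : Type*} {n : ℕ}

section Combinatorics

variable {ι : Type*}

set_option maxHeartbeats 2000000 in
theorem exists_numeric_exchange {a₁ a₂ b₁ b₂ b₃ : ℕ} (ha₁ : 0 < a₁) (ha₂ : 0 < a₂)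
    (hb₁ : 0 < b₁) (hb₂ : 0 < b₂) (h : a₁ + a₂ = b₁ + b₂ + b₃) (h3 : 3 ≤ a₁ + a₂)
    (h4 : 0 < b₃ → 4 ≤ a₁ + a₂) :
    ∃ x₁ x₂ y₁ y₂ y₃ : ℕ, x₁ + x₂ + (y₁ + y₂ + y₃) = a₁ + a₂ ∧ (0 < x₁ ∨ 0 < x₂) ∧
      (0 < y₁ ∨ 0 < y₂ ∨ 0 < y₃ ∧ 0 < b₃) ∧
      ∀ s₁ s₂ t₁ t₂ t₃ : ℕ, s₁ ≤ 1 → s₂ ≤ 1 → t₁ ≤ 1 → t₂ ≤ 1 → t₃ ≤ 1 →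
        x₁ * s₁ + x₂ * s₂ + (y₁ * t₁ + y₂ * t₂ + y₃ * t₃) ≤
          max (a₁ * s₁ + a₂ * s₂) (b₁ * t₁ + b₂ * t₂ + b₃ * t₃) := by
  have key : ∀ x₁ x₂ y₁ y₂ y₃ : ℕ,
      (x₁ + x₂ + (y₁ + y₂ + y₃) = a₁ + a₂ ∧ (0 < x₁ ∨ 0 < x₂) ∧
        (0 < y₁ ∨ 0 < y₂ ∨ 0 < y₃ ∧ 0 < b₃)) →
      (∀ s₁ s₂ t₁ t₂ t₃ : ℕ, s₁ = 0 ∨ s₁ = 1 → s₂ = 0 ∨ s₂ = 1 → t₁ = 0 ∨ t₁ = 1 →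
        t₂ = 0 ∨ t₂ = 1 → t₃ = 0 ∨ t₃ = 1 →
        x₁ * s₁ + x₂ * s₂ + (y₁ * t₁ + y₂ * t₂ + y₃ * t₃) ≤
          max (a₁ * s₁ + a₂ * s₂) (b₁ * t₁ + b₂ * t₂ + b₃ * t₃)) →
      ∃ x₁ x₂ y₁ y₂ y₃ : ℕ, x₁ + x₂ + (y₁ + y₂ + y₃) = a₁ + a₂ ∧ (0 < x₁ ∨ 0 < x₂) ∧
        (0 < y₁ ∨ 0 < y₂ ∨ 0 < y₃ ∧ 0 < b₃) ∧
        ∀ s₁ s₂ t₁ t₂ t₃ : ℕ, s₁ ≤ 1 → s₂ ≤ 1 → t₁ ≤ 1 → t₂ ≤ 1 → t₃ ≤ 1 →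
          x₁ * s₁ + x₂ * s₂ + (y₁ * t₁ + y₂ * t₂ + y₃ * t₃) ≤
            max (a₁ * s₁ + a₂ * s₂) (b₁ * t₁ + b₂ * t₂ + b₃ * t₃) := by
    intro x₁ x₂ y₁ y₂ y₃ ⟨h₁, h₂, h₃⟩ H
    exact ⟨x₁, x₂, y₁, y₂, y₃, h₁, h₂, h₃, fun s₁ s₂ t₁ t₂ t₃ _ _ _ _ _ =>
      H s₁ s₂ t₁ t₂ t₃ (by omega) (by omega) (by omega) (by omega) (by omega)⟩
  have hcases :
      (a₁ + a₂ < a₁ + b₁ ∨ a₁ + a₂ < a₁ + b₂ ∨ a₁ + a₂ < a₁ + b₃ ∨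
        a₁ + a₂ < a₂ + b₁ ∨ a₁ + a₂ < a₂ + b₂ ∨ a₁ + a₂ < a₂ + b₃) ∨
      (b₁ ≤ a₁ ∧ b₂ ≤ a₁ ∧ b₃ ≤ a₁ ∧ b₁ ≤ a₂ ∧ b₂ ≤ a₂ ∧ b₃ ≤ a₂) ∧
        ((b₁ < a₁ ∧ b₁ < a₂) ∨ (b₂ < a₁ ∧ b₂ < a₂) ∨ (b₃ < a₁ ∧ b₃ < a₂) ∨
          (b₁ = a₂ ∧ b₂ = a₂ ∧ b₃ = a₂ ∧ a₁ = 2 * a₂ ∧ 2 ≤ a₂) ∨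
          (b₁ = a₁ ∧ b₂ = a₁ ∧ b₃ = a₁ ∧ a₂ = 2 * a₁ ∧ 2 ≤ a₁)) := by
    omega
  rcases hcases with (h' | h' | h' | h' | h' | h') | ⟨hle, h' | h' | h' | h' | h'⟩
  on_goal 1 => refine key (a₁ - 1) a₂ 1 0 0 (by omega) ?_
  on_goal 2 => refine key (a₁ - 1) a₂ 0 1 0 (by omega) ?_
  on_goal 3 => refine key (a₁ - 1) a₂ 0 0 1 (by omega) ?_
  on_goal 4 => refine key a₁ (a₂ - 1) 1 0 0 (by omega) ?_
  on_goal 5 => refine key a₁ (a₂ - 1) 0 1 0 (by omega) ?_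
  on_goal 6 => refine key a₁ (a₂ - 1) 0 0 1 (by omega) ?_
  on_goal 7 => refine key (a₁ - 1) (a₂ - 1) 0 1 1 (by omega) ?_
  on_goal 8 => refine key (a₁ - 1) (a₂ - 1) 1 0 1 (by omega) ?_
  on_goal 9 => refine key (a₁ - 1) (a₂ - 1) 1 1 0 (by omega) ?_
  on_goal 10 => refine key (a₁ - 2) (a₂ - 1) 1 1 1 (by omega) ?_
  on_goal 11 => refine key (a₁ - 1) (a₂ - 2) 1 1 1 (by omega) ?_
  all_goals
    rintro _ _ _ _ _ (rfl | rfl) (rfl | rfl) (rfl | rfl) (rfl | rfl) (rfl | rfl) <;> omega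

/-- `c` is an exponent vector of the same degree as `a`, sharing a variable with each of `a` and
`b`, and whose image under `e` divides the least common multiple of the images of `a` and `b`. -/
def IsBridge (e : ι → σ →₀ ℕ) (a b c : ι →₀ ℕ) : Prop :=
  c.degree = a.degree ∧ Finsupp.weight e c ≤ Finsupp.weight e a ⊔ Finsupp.weight e b ∧
    (∃ i, a i ≠ 0 ∧ c i ≠ 0) ∧ ∃ j, b j ≠ 0 ∧ c j ≠ 0

theorem IsBridge.symm {e : ι → σ →₀ ℕ} {a b c : ι →₀ ℕ} (hdeg : a.degree = b.degree)
    (h : IsBridge e a b c) : IsBridge e b a c :=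
  ⟨h.1.trans hdeg, by rw [sup_comm]; exact h.2.1, h.2.2.2, h.2.2.1⟩

theorem exists_isBridge_of_single {e : ι → σ →₀ ℕ} (hsf : ∀ i, SqFreeExp (e i)) {a b : ι →₀ ℕ}
    (hdeg : a.degree = b.degree) (h2 : 2 ≤ a.degree) (ha : a.support.card = 1) :
    ∃ c, IsBridge e a b c := by
  obtain ⟨i, m, hm, rfl⟩ := Finsupp.card_support_eq_one'.1 ha
  simp only [Finsupp.degree_single] at hdeg h2
  obtain ⟨j, hj⟩ : ∃ j, b j ≠ 0 := by
    by_contra! hb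
    have : b = 0 := Finsupp.ext hb
    simp [this] at hdeg
    omega
  refine ⟨Finsupp.single i (m - 1) + Finsupp.single j 1, ?_, fun x => ?_, ⟨i, ?_, ?_⟩, j, hj, ?_⟩
  · simp only [map_add, Finsupp.degree_single]
    omega
  · have hle : Finsupp.single j 1 ≤ b := Finsupp.single_le_iff.2 (by omega)
    have hw := Finsupp.le_def.1 (show Finsupp.weight e (Finsupp.single j 1) ≤ Finsupp.weight e b by
      rw [← tsub_add_cancel_of_le hle, map_add]
      exact le_add_self) x
    have h₁ := hsf i x
    have h₂ := hsf j x
    simp only [map_add, Finsupp.weight_single, Finsupp.add_apply, Finsupp.smul_apply,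
      Finsupp.sup_apply, smul_eq_mul] at hw ⊢
    obtain h | h : e i x = 0 ∨ e i x = 1 := by omega
    all_goals rw [h]; omega
  · simpa using hm
  · simp
    omega
  · simp

theorem exists_isBridge_of_pair_of_triple {e : ι → σ →₀ ℕ} (hsf : ∀ i, SqFreeExp (e i))
    {i₁ i₂ j₁ j₂ j₃ : ι} {a₁ a₂ b₁ b₂ b₃ : ℕ} (ha₁ : 0 < a₁) (ha₂ : 0 < a₂)
    (hb₁ : 0 < b₁) (hb₂ : 0 < b₂) (h : a₁ + a₂ = b₁ + b₂ + b₃) (h3 : 3 ≤ a₁ + a₂)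
    (h4 : 0 < b₃ → 4 ≤ a₁ + a₂) :
    ∃ c, IsBridge e (Finsupp.single i₁ a₁ + Finsupp.single i₂ a₂)
      (Finsupp.single j₁ b₁ + Finsupp.single j₂ b₂ + Finsupp.single j₃ b₃) c := by
  obtain ⟨x₁, x₂, y₁, y₂, y₃, hsum, hx, hy, hle⟩ :=
    exists_numeric_exchange ha₁ ha₂ hb₁ hb₂ h h3 h4
  refine ⟨Finsupp.single i₁ x₁ + Finsupp.single i₂ x₂ +
    (Finsupp.single j₁ y₁ + Finsupp.single j₂ y₂ + Finsupp.single j₃ y₃), ?_, fun x => ?_, ?_, ?_⟩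
  · simpa only [map_add, Finsupp.degree_single] using hsum
  · simpa only [map_add, Finsupp.weight_single, Finsupp.add_apply, Finsupp.smul_apply,
      Finsupp.sup_apply, smul_eq_mul] using hle _ _ _ _ _ (hsf i₁ x) (hsf i₂ x) (hsf j₁ x)
        (hsf j₂ x) (hsf j₃ x)
  · rcases hx with hx | hx
    · exact ⟨i₁, by simp; omega, by simp; omega⟩
    · exact ⟨i₂, by simp; omega, by simp; omega⟩
  · rcases hy with hy | hy | hy
    · exact ⟨j₁, by simp; omega, by simp; omega⟩
    · exact ⟨j₂, by simp; omega, by simp; omega⟩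
    · exact ⟨j₃, by simp; omega, by simp; omega⟩

theorem exists_single_add_single {a : ι →₀ ℕ} (ha : a.support.card = 2) :
    ∃ i j a₁ a₂, 0 < a₁ ∧ 0 < a₂ ∧ a = Finsupp.single i a₁ + Finsupp.single j a₂ := by
  classical
  obtain ⟨i, j, hij, hs⟩ := Finset.card_eq_two.1 ha
  refine ⟨i, j, a i, a j, ?_, ?_, ?_⟩
  · exact Nat.pos_of_ne_zero (Finsupp.mem_support_iff.1 (by simp [hs]))
  · exact Nat.pos_of_ne_zero (Finsupp.mem_support_iff.1 (by simp [hs]))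
  · conv_lhs => rw [← Finsupp.sum_single a, Finsupp.sum, hs, Finset.sum_pair hij]

theorem exists_single_add_single_add_single {a : ι →₀ ℕ} (ha : a.support.card = 3) :
    ∃ i j l a₁ a₂ a₃, 0 < a₁ ∧ 0 < a₂ ∧
      a = Finsupp.single i a₁ + Finsupp.single j a₂ + Finsupp.single l a₃ := by
  classical
  obtain ⟨i, j, l, hij, hil, hjl, hs⟩ := Finset.card_eq_three.1 ha
  refine ⟨i, j, l, a i, a j, a l, ?_, ?_, ?_⟩
  · exact Nat.pos_of_ne_zero (Finsupp.mem_support_iff.1 (by simp [hs]))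
  · exact Nat.pos_of_ne_zero (Finsupp.mem_support_iff.1 (by simp [hs]))
  · conv_lhs => rw [← Finsupp.sum_single a, Finsupp.sum, hs]
    rw [Finset.sum_insert (by simp [hij, hil]), Finset.sum_pair hjl, add_assoc]

theorem exists_isBridge_of_card_support_eq_two {e : ι → σ →₀ ℕ} (hsf : ∀ i, SqFreeExp (e i))
    {a b : ι →₀ ℕ} (hdeg : a.degree = b.degree) (ha : a.support.card = 2)
    (hb : b.support.card = 2 ∧ 3 ≤ a.degree ∨ b.support.card = 3 ∧ 4 ≤ a.degree) :
    ∃ c, IsBridge e a b c := by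
  obtain ⟨i₁, i₂, a₁, a₂, ha₁, ha₂, rfl⟩ := exists_single_add_single ha
  simp only [map_add, Finsupp.degree_single] at hdeg hb
  rcases hb with ⟨hb, h3⟩ | ⟨hb, h4⟩
  · obtain ⟨j₁, j₂, b₁, b₂, hb₁, hb₂, rfl⟩ := exists_single_add_single hb
    simp only [map_add, Finsupp.degree_single] at hdeg
    simpa using exists_isBridge_of_pair_of_triple (e := e) hsf (i₁ := i₁) (i₂ := i₂) (j₁ := j₁)
      (j₂ := j₂) (j₃ := j₂) (b₃ := 0) ha₁ ha₂ hb₁ hb₂ hdeg h3 (by simp)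
  · obtain ⟨j₁, j₂, j₃, b₁, b₂, b₃, hb₁, hb₂, rfl⟩ := exists_single_add_single_add_single hb
    simp only [map_add, Finsupp.degree_single] at hdeg
    exact exists_isBridge_of_pair_of_triple hsf ha₁ ha₂ hb₁ hb₂ hdeg (by omega) (fun _ => h4)

theorem exists_isBridge [Fintype ι] {e : ι → σ →₀ ℕ} (hsf : ∀ i, SqFreeExp (e i))
    (hn : Fintype.card ι ≤ 5) {a b : ι →₀ ℕ} (hdeg : a.degree = b.degree)
    (hdisj : ∀ i, a i = 0 ∨ b i = 0) (hlt : max (Fintype.card ι - 2) 1 < a.degree) :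
    ∃ c, IsBridge e a b c := by
  classical
  have hcard : a.support.card + b.support.card ≤ Fintype.card ι := by
    rw [← Finset.card_union_of_disjoint]
    · exact Finset.card_le_univ _
    · rw [Finset.disjoint_left]
      intro i hi hi'
      rw [Finsupp.mem_support_iff] at hi hi'
      exact (hdisj i).elim hi hi'
  have hpos : ∀ c : ι →₀ ℕ, 0 < c.degree → 0 < c.support.card := by
    intro c hc
    rw [Finset.card_pos, Finsupp.support_nonempty_iff]
    rintro rfl
    simp at hc
  have hpa := hpos a (by omega)
  have hpb := hpos b (by omega)
  rcases (show a.support.card = 1 ∨ b.support.card = 1 ∨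
      (a.support.card = 2 ∧ (b.support.card = 2 ∧ 3 ≤ a.degree ∨
        b.support.card = 3 ∧ 4 ≤ a.degree)) ∨
      (b.support.card = 2 ∧ (a.support.card = 2 ∧ 3 ≤ b.degree ∨
        a.support.card = 3 ∧ 4 ≤ b.degree)) by omega) with h | h | h | h
  · exact exists_isBridge_of_single hsf hdeg (by omega) h
  · obtain ⟨c, hc⟩ := exists_isBridge_of_single (a := b) (b := a) hsf hdeg.symm (by omega) h
    exact ⟨c, hc.symm hdeg.symm⟩
  · exact exists_isBridge_of_card_support_eq_two hsf hdeg h.1 h.2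
  · obtain ⟨c, hc⟩ := exists_isBridge_of_card_support_eq_two hsf hdeg.symm h.1 h.2
    exact ⟨c, hc.symm hdeg.symm⟩

theorem exists_sum_single_eq (s : ℕ) (a : ι →₀ ℕ) (ha : a.degree = s) :
    ∃ α : Fin s → ι, ∑ i, Finsupp.single (α i) 1 = a := by
  induction s generalizing a with
  | zero => exact ⟨Fin.elim0, by simpa using ((Finsupp.degree_eq_zero_iff a).1 ha).symm⟩
  | succ s ih =>
    obtain ⟨i, hi⟩ : ∃ i, a i ≠ 0 := by
      by_contra! h
      simp [show a = 0 from Finsupp.ext h] at ha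
    have hle : Finsupp.single i 1 ≤ a := Finsupp.single_le_iff.2 (by omega)
    have hsplit := tsub_add_cancel_of_le hle
    obtain ⟨α, hα⟩ := ih (a - Finsupp.single i 1) (by
      rw [← hsplit, map_add, Finsupp.degree_single] at ha
      omega)
    refine ⟨Fin.cons i α, ?_⟩
    rw [Fin.sum_univ_succ]
    simp only [Fin.cons_zero, Fin.cons_succ, hα]
    rw [add_comm, hsplit]

end Combinatorics

theorem Tab_eq (e : Fin n → σ →₀ ℕ) {s : ℕ} (α β : Fin s → Fin n) :
    Tab k e α β =
      monomial (∑ i, Finsupp.single (α i) 1)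
        (monomial ((∑ i, e (β i)) - expGcd (∑ i, e (α i)) (∑ i, e (β i))) (1 : k)) -
      monomial (∑ i, Finsupp.single (β i) 1)
        (monomial ((∑ i, e (α i)) - expGcd (∑ i, e (α i)) (∑ i, e (β i))) (1 : k)) := by
  simp only [Tab, X, ← monomial_sum_one, C_mul_monomial, mul_one]

theorem weight_sum_single (e : Fin n → σ →₀ ℕ) {s : ℕ} (α : Fin s → Fin n) :
    Finsupp.weight e (∑ i, Finsupp.single (α i) 1) = ∑ i, e (α i) := by
  simp [map_sum, Finsupp.weight_single]

theorem degree_sum_single {s : ℕ} (α : Fin s → Fin n) :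
    (∑ i, Finsupp.single (α i) 1 : Fin n →₀ ℕ).degree = s := by
  simp [map_sum]

theorem reesMap_monomial (e : Fin n → σ →₀ ℕ) (a : Fin n →₀ ℕ) (u : σ →₀ ℕ) (c : k) :
    reesMap k e (monomial a (monomial u c)) =
      Polynomial.monomial a.degree (monomial (u + Finsupp.weight e a) c) := by
  have key : (a.prod fun i m =>
      (Polynomial.C (monomial (e i) (1 : k)) * Polynomial.X : Polynomial (MvPolynomial σ k)) ^ m) =
      Polynomial.monomial a.degree (monomial (Finsupp.weight e a) 1) := by
    induction a using Finsupp.induction_linear with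
    | zero => simp
    | add f g hf hg =>
      rw [Finsupp.prod_add_index' (by simp) (by simp [pow_add]), hf, hg,
        Polynomial.monomial_mul_monomial, monomial_mul, map_add, map_add, mul_one]
    | single i m =>
      rw [Finsupp.prod_single_index (by simp), mul_pow, ← Polynomial.C_pow, monomial_pow,
        Polynomial.C_mul_X_pow_eq_monomial, Finsupp.degree_single, Finsupp.weight_single, one_pow]
  rw [reesMap, aeval_monomial, key, Polynomial.algebraMap_eq, Polynomial.C_mul_monomial,
    monomial_mul, mul_one]

theorem Tab_mem_ker (e : Fin n → σ →₀ ℕ) {s : ℕ} (α β : Fin s → Fin n) :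
    Tab k e α β ∈ RingHom.ker (reesMap k e) := by
  rw [RingHom.mem_ker, Tab_eq, map_sub, reesMap_monomial, reesMap_monomial, sub_eq_zero,
    weight_sum_single, weight_sum_single, degree_sum_single, degree_sum_single]
  congr 3
  ext x
  simp only [expGcd, Finsupp.add_apply, Finsupp.tsub_apply, Finsupp.inf_apply]
  omega

theorem Tab_isHomogeneous (e : Fin n → σ →₀ ℕ) {s : ℕ} (α β : Fin s → Fin n) :
    (Tab k e α β).IsHomogeneous s := by
  rw [Tab_eq]
  exact (isHomogeneous_monomial _ (degree_sum_single α)).sub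
    (isHomogeneous_monomial _ (degree_sum_single β))

variable {k} in
/-- A `k`-linear section argument: an ideal containing every binomial of the kernel contains the
kernel. -/
theorem ker_reesMap_le (e : Fin n → σ →₀ ℕ)
    {M : Ideal (MvPolynomial (Fin n) (MvPolynomial σ k))}
    (hM : ∀ (a b : Fin n →₀ ℕ) (u v : σ →₀ ℕ), a.degree = b.degree →
      u + Finsupp.weight e a = v + Finsupp.weight e b →
      monomial a (monomial u (1 : k)) - monomial b (monomial v (1 : k)) ∈ M) :
    RingHom.ker (reesMap k e) ≤ M := by
  classical
  let rep : ℕ → (σ →₀ ℕ) → MvPolynomial (Fin n) (MvPolynomial σ k) ⧸ M := fun s w =>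
    if h : ∃ q : (Fin n →₀ ℕ) × (σ →₀ ℕ), q.1.degree = s ∧ q.2 + Finsupp.weight e q.1 = w then
      Ideal.Quotient.mk M (monomial h.choose.1 (monomial h.choose.2 1)) else 0
  have hrep : ∀ (a : Fin n →₀ ℕ) (u : σ →₀ ℕ), rep a.degree (u + Finsupp.weight e a) =
      Ideal.Quotient.mk M (monomial a (monomial u 1)) := by
    intro a u
    have h : ∃ q : (Fin n →₀ ℕ) × (σ →₀ ℕ), q.1.degree = a.degree ∧
        q.2 + Finsupp.weight e q.1 = u + Finsupp.weight e a := ⟨(a, u), rfl, rfl⟩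
    simp only [rep, dif_pos h]
    exact Ideal.Quotient.eq.2 (hM _ _ _ _ h.choose_spec.1 h.choose_spec.2)
  let ψ : Polynomial (MvPolynomial σ k) →ₗ[k] MvPolynomial (Fin n) (MvPolynomial σ k) ⧸ M :=
    Polynomial.lsum fun s => (basisMonomials σ k).constr k (rep s)
  have hψ : ∀ p, ψ (reesMap k e p) = Ideal.Quotient.mk M p := by
    intro p
    induction p using MvPolynomial.induction_on' with
    | add p q hp hq => rw [map_add, map_add, map_add, hp, hq]
    | monomial a r =>
      induction r using MvPolynomial.induction_on' with
      | add r r' h h' => rw [map_add, map_add, map_add, map_add, h, h']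
      | monomial u c =>
        have hc : (monomial u c : MvPolynomial σ k) = c • monomial u 1 := by
          rw [smul_monomial, smul_eq_mul, mul_one]
        have hb : (monomial (u + Finsupp.weight e a) 1 : MvPolynomial σ k) =
          basisMonomials σ k (u + Finsupp.weight e a) := by simp
        have h1 : ψ (reesMap k e (monomial a (monomial u 1))) =
            Ideal.Quotient.mk M (monomial a (monomial u 1)) := by
          rw [reesMap_monomial, ← hrep]
          simp only [ψ, Polynomial.lsum_apply]
          rw [Polynomial.sum_monomial_index _ _ (by simp), hb, Module.Basis.constr_basis]
        have hs : (monomial a (c • monomial u 1 : MvPolynomial σ k)) =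
            c • monomial a (monomial u (1 : k)) := (smul_monomial c).symm
        rw [hc, hs]
        have h2 : reesMap k e (c • monomial a (monomial u (1 : k))) =
            c • reesMap k e (monomial a (monomial u (1 : k))) :=
          map_smul ((reesMap k e).restrictScalars k) c _
        rw [h2, map_smul, h1]
        exact (map_smul (Ideal.Quotient.mkₐ k M) c _).symm
  intro p hp
  rw [← Ideal.Quotient.eq_zero_iff_mem, ← hψ, (RingHom.mem_ker).1 hp, map_zero]

variable {k} in
theorem monomial_sub_monomial_mem_of_degree_eq {e : Fin n → σ →₀ ℕ} {s : ℕ}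
    {M : Ideal (MvPolynomial (Fin n) (MvPolynomial σ k))} (hM : Jset k e s ⊆ M)
    {a b : Fin n →₀ ℕ} {u v : σ →₀ ℕ} (ha : a.degree = s) (hb : b.degree = s)
    (h : u + Finsupp.weight e a = v + Finsupp.weight e b) :
    monomial a (monomial u (1 : k)) - monomial b (monomial v (1 : k)) ∈ M := by
  obtain ⟨α, rfl⟩ := exists_sum_single_eq s a ha
  obtain ⟨β, rfl⟩ := exists_sum_single_eq s b hb
  have hT := M.mul_mem_left
    (C (monomial (u - ((∑ i, e (β i)) - expGcd (∑ i, e (α i)) (∑ i, e (β i)))) 1))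
    (hM ⟨α, β, rfl⟩)
  rw [Tab_eq, mul_sub, C_mul_monomial, C_mul_monomial, monomial_mul, monomial_mul, mul_one] at hT
  rw [weight_sum_single, weight_sum_single] at h
  convert hT using 4
  all_goals
    congr 1
    ext x
    have hx := DFunLike.congr_fun h x
    simp only [expGcd, Finsupp.add_apply, Finsupp.tsub_apply, Finsupp.inf_apply] at hx ⊢
    omega

variable {k} in
theorem monomial_sub_monomial_mem {e : Fin n → σ →₀ ℕ} (hsf : ∀ i, SqFreeExp (e i)) (hn : n ≤ 5)
    {M : Ideal (MvPolynomial (Fin n) (MvPolynomial σ k))}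
    (hM : ∀ s ∈ Set.Icc 1 (max (n - 2) 1), Jset k e s ⊆ M) (d : ℕ) (a b : Fin n →₀ ℕ)
    (u v : σ →₀ ℕ) (ha : a.degree = d) (hb : b.degree = d)
    (h : u + Finsupp.weight e a = v + Finsupp.weight e b) :
    monomial a (monomial u (1 : k)) - monomial b (monomial v (1 : k)) ∈ M := by
  induction d generalizing a b u v with
  | zero =>
    obtain rfl := (Finsupp.degree_eq_zero_iff a).1 ha
    obtain rfl := (Finsupp.degree_eq_zero_iff b).1 hb
    obtain rfl : u = v := by simpa using h
    simp
  | succ d ih =>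
    have common : ∀ (a b : Fin n →₀ ℕ) (u v : σ →₀ ℕ), a.degree = d + 1 → b.degree = d + 1 →
        u + Finsupp.weight e a = v + Finsupp.weight e b → (∃ i, a i ≠ 0 ∧ b i ≠ 0) →
        monomial a (monomial u (1 : k)) - monomial b (monomial v (1 : k)) ∈ M := by
      rintro a b u v ha hb h ⟨i, hia, hib⟩
      obtain ⟨a, rfl⟩ := exists_add_of_le
        (Finsupp.single_le_iff.2 (Nat.one_le_iff_ne_zero.2 hia))
      obtain ⟨b, rfl⟩ := exists_add_of_le
        (Finsupp.single_le_iff.2 (Nat.one_le_iff_ne_zero.2 hib))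
      simp only [map_add, Finsupp.degree_single] at ha hb h
      have hmem := M.mul_mem_left (X i) (ih a b u v (by omega) (by omega)
        (by rwa [add_left_comm, add_left_comm v, add_left_cancel_iff] at h))
      rwa [mul_sub, X, monomial_mul, monomial_mul, one_mul, one_mul] at hmem
    by_cases hab : ∃ i, a i ≠ 0 ∧ b i ≠ 0
    · exact common a b u v ha hb h hab
    by_cases hd : d + 1 ≤ max (n - 2) 1
    · exact monomial_sub_monomial_mem_of_degree_eq (hM (d + 1) ⟨by omega, hd⟩) ha hb h
    obtain ⟨c, hc, hle, hac, j, hjb, hjc⟩ := exists_isBridge hsf (by simpa using hn)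
      (ha.trans hb.symm) (fun i => by by_contra! hi; exact hab ⟨i, hi⟩)
      (by simp only [Fintype.card_fin]; omega)
    have hle' : Finsupp.weight e c ≤ u + Finsupp.weight e a :=
      hle.trans (sup_le le_add_self (h ▸ le_add_self))
    have hw := tsub_add_cancel_of_le hle'
    rw [← sub_add_sub_cancel _ (monomial c (monomial (u + Finsupp.weight e a - Finsupp.weight e c)
      (1 : k)))]
    exact M.add_mem (common _ _ _ _ ha (hc.trans ha) hw.symm hac)
      (common _ _ _ _ (hc.trans ha) hb (hw.trans h) ⟨j, hjc, hjb⟩)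

/-- If `I` is generated by `n ≤ 5` square-free monomials, then the defining ideal of the
Rees algebra satisfies `ker φ = span(J_1 ∪ J_2 ∪ … ∪ J_{n-2})` (where for `n ≤ 3` the
right-hand side is `span(J_1)`, whence the `max (n-2) 1`).  In particular the relation
type of `I` is at most `n - 2`:  `ker φ` is generated by its elements that are
homogeneous of degree at most `n - 2` in the variables `T_1, …, T_n`. -/
theorem kernel_eq_span_of_card_le_five
    (e : Fin n → (σ →₀ ℕ)) (hsf : ∀ i, SqFreeExp (e i))
    (hmin : ∀ i j : Fin n, i ≠ j →
      ¬ ((monomial (e i) (1 : k) : MvPolynomial σ k) ∣ monomial (e j) (1 : k)))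
    (hn : n ≤ 5) :
    RingHom.ker (reesMap k e)
        = Ideal.span (⋃ i ∈ Set.Icc 1 (max (n - 2) 1), Jset k e i) ∧
      RingHom.ker (reesMap k e)
        = Ideal.span { p | p ∈ RingHom.ker (reesMap k e) ∧
            ∃ i ≤ max (n - 2) 1, MvPolynomial.IsHomogeneous p i } := by
  have hker : RingHom.ker (reesMap k e)
      = Ideal.span (⋃ i ∈ Set.Icc 1 (max (n - 2) 1), Jset k e i) := by
    refine le_antisymm (ker_reesMap_le e fun a b u v hab h => ?_) (Ideal.span_le.2 ?_)
    · exact monomial_sub_monomial_mem hsf hn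
        (fun s hs => (Set.subset_biUnion_of_mem hs).trans Ideal.subset_span) _ a b u v rfl hab.symm h
    · refine Set.iUnion₂_subset fun s _ => ?_
      rintro _ ⟨α, β, rfl⟩
      exact Tab_mem_ker k e α β
  refine ⟨hker, le_antisymm ?_ (Ideal.span_le.2 fun p hp => hp.1)⟩
  conv_lhs => rw [hker]
  refine Ideal.span_mono (Set.iUnion₂_subset fun s hs => ?_)
  rintro _ ⟨α, β, rfl⟩
  exact ⟨Tab_mem_ker k e α β, s, hs.2, Tab_isHomogeneous k e α β⟩
end
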